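/- Let E be a finitely generated projective S-module with dual basis (e₁,…,eₙ; α₁,…,αₙ), let ∇ be a connection on E, let ∇* be the unique connection on E* = Hom_S(E,S) satisfying D(α(e)) = Σⱼ βⱼ(e) • ωⱼ + Σₖ α(fₖ) • ηₖ (where ∇*(α) = Σⱼ ωⱼ ⊗ βⱼ and ∇(e) = Σₖ ηₖ ⊗ fₖ), and let ∇_{E⊗E*} be the tensor product connection on E ⊗[S] E* determined by ∇_{E⊗E*}(e ⊗ α) = Σₖ ηₖ ⊗ (fₖ ⊗ α) + Σⱼ ωⱼ ⊗ (e ⊗ βⱼ). Then the Kronecker delta δ = Σᵢ eᵢ ⊗ αᵢ ∈ E ⊗[S] E* satisfies ∇_{E⊗E*}(δ) = 0. -/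

import Mathlib

open scoped TensorProduct

/-- A connection on an `S`-module `E` (over the base ring `R`). -/
def IsConnection (R S : Type*) [CommRing R] [CommRing S] [Algebra R S]
    {E : Type*} [AddCommGroup E] [Module R E] [Module S E] [IsScalarTower R S E]
    (nabla : E →ₗ[R] KaehlerDifferential R S ⊗[S] E) : Prop :=
  ∀ (s : S) (x : E),
    nabla (s • x) = (KaehlerDifferential.D R S) s ⊗ₜ[S] x + s • nabla x

/-- Contraction `Ω ⊗ E* → Ω`, `ω ⊗ β ↦ β(e) • ω`, for a fixed `e : E`. -/
noncomputable def evDual (R S : Type*) [CommRing R] [CommRing S] [Algebra R S]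
    {E : Type*} [AddCommGroup E] [Module S E] (x : E) :
    KaehlerDifferential R S ⊗[S] (E →ₗ[S] S) →ₗ[S] KaehlerDifferential R S :=
  TensorProduct.lift
    (((LinearMap.lsmul S (KaehlerDifferential R S)).comp (LinearMap.applyₗ x)).flip)

/-- Contraction `Ω ⊗ E → Ω`, `η ⊗ f ↦ α(f) • η`, for a fixed functional `α : E →ₗ[S] S`. -/
noncomputable def evMod (R S : Type*) [CommRing R] [CommRing S] [Algebra R S]
    {E : Type*} [AddCommGroup E] [Module S E] (a : E →ₗ[S] S) :
    KaehlerDifferential R S ⊗[S] E →ₗ[S] KaehlerDifferential R S :=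
  TensorProduct.lift (((LinearMap.lsmul S (KaehlerDifferential R S)).comp a).flip)

theorem dual_eq_sum {S E : Type*} [CommRing S] [AddCommGroup E] [Module S E]
    {n : ℕ} {e : Fin n → E} {α : Fin n → (E →ₗ[S] S)}
    (hdual : ∀ x : E, ∑ i, α i x • e i = x) (b : E →ₗ[S] S) :
    ∑ i, b (e i) • α i = b := by
  ext x
  conv_rhs => rw [← hdual x]
  simp [mul_comm]

theorem sum_evMod_tmul (R : Type*) {S E : Type*} [CommRing R] [CommRing S] [Algebra R S]
    [AddCommGroup E] [Module S E]
    {n : ℕ} {e : Fin n → E} {α : Fin n → (E →ₗ[S] S)}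
    (hdual : ∀ x : E, ∑ i, α i x • e i = x) (u : KaehlerDifferential R S ⊗[S] E) :
    ∑ i, evMod R S (α i) u ⊗ₜ[S] e i = u := by
  induction u with
  | zero => simp
  | tmul ω x =>
    conv_rhs => rw [← hdual x]
    simp [evMod, TensorProduct.tmul_sum, TensorProduct.smul_tmul]
  | add u v hu hv => simp [TensorProduct.add_tmul, Finset.sum_add_distrib, hu, hv]

theorem sum_evDual_tmul (R : Type*) {S E : Type*} [CommRing R] [CommRing S] [Algebra R S]
    [AddCommGroup E] [Module S E]
    {n : ℕ} {e : Fin n → E} {α : Fin n → (E →ₗ[S] S)}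
    (hdual : ∀ x : E, ∑ i, α i x • e i = x)
    (u : KaehlerDifferential R S ⊗[S] (E →ₗ[S] S)) :
    ∑ i, evDual R S (e i) u ⊗ₜ[S] α i = u := by
  induction u with
  | zero => simp
  | tmul ω b =>
    conv_rhs => rw [← dual_eq_sum hdual b]
    simp [evDual, TensorProduct.tmul_sum, TensorProduct.smul_tmul]
  | add u v hu hv => simp [TensorProduct.add_tmul, Finset.sum_add_distrib, hu, hv]

/-- For the idempotent matrix `P i j = α i (e j)` this is the identity `P (dP) P = 0`. -/
theorem sum_D_tmul_eq_zero {R S E : Type*} [CommRing R] [CommRing S] [Algebra R S]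
    [AddCommGroup E] [Module R E] [Module S E] [IsScalarTower R S E]
    {n : ℕ} {e : Fin n → E} {α : Fin n → (E →ₗ[S] S)}
    (hdual : ∀ x : E, ∑ i, α i x • e i = x)
    {nabla : E →ₗ[R] KaehlerDifferential R S ⊗[S] E} (h : IsConnection R S nabla) :
    ∑ j, ∑ i, KaehlerDifferential.D R S (α i (e j)) ⊗ₜ[S] (e i ⊗ₜ[S] α j) = 0 := by
  have hD (x : E) : ∑ i, KaehlerDifferential.D R S (α i x) ⊗ₜ[S] e i
      = nabla x - ∑ i, α i x • nabla (e i) := by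
    have hx : nabla x = ∑ i, nabla (α i x • e i) := by rw [← map_sum, hdual]
    rw [hx]
    simp only [h _ _, Finset.sum_add_distrib, add_sub_cancel_right]
  let L (b : E →ₗ[S] S) := LinearMap.lTensor (KaehlerDifferential R S)
    ((TensorProduct.mk S E (E →ₗ[S] S)).flip b)
  have hL (b : E →ₗ[S] S) (u : KaehlerDifferential R S ⊗[S] E) :
      ∑ j, b (e j) • L (α j) u = L b u := by
    induction u with
    | zero => simp
    | tmul ω x =>
      conv_rhs => rw [← dual_eq_sum hdual b]
      simp [L, TensorProduct.tmul_sum]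
    | add u v hu hv => simp [Finset.sum_add_distrib, hu, hv]
  calc _ = ∑ j, L (α j) (∑ i, KaehlerDifferential.D R S (α i (e j)) ⊗ₜ[S] e i) := by
        simp [L]
    _ = ∑ j, L (α j) (nabla (e j)) - ∑ i, ∑ j, α i (e j) • L (α j) (nabla (e i)) := by
        rw [Finset.sum_comm (γ := Fin n)]
        simp [hD, Finset.sum_sub_distrib]
    _ = 0 := by simp [hL]

/-- let `E` be finitely generated projective with dual basis `(e i, α i)`,
`∇` a connection on `E`, `∇*` the dual connection on `E* = Hom_S(E,S)` (characterized by
`D(α(e)) = Σⱼ βⱼ(e) • ωⱼ + Σₖ α(fₖ) • ηₖ`), and `∇_{E⊗E*}` the tensor product connection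
on `E ⊗[S] E*` (with `∇_{E⊗E*}(e ⊗ α) = Σₖ ηₖ ⊗ (fₖ ⊗ α) + Σⱼ ωⱼ ⊗ (e ⊗ βⱼ)`).
Then the Kronecker delta `δ = Σᵢ e i ⊗ α i` satisfies `∇_{E⊗E*}(δ) = 0`. -/
theorem stmt8 (R S : Type*) [CommRing R] [CommRing S] [Algebra R S]
    (E : Type*) [AddCommGroup E] [Module R E] [Module S E] [IsScalarTower R S E]
    (n : ℕ) (e : Fin n → E) (α : Fin n → (E →ₗ[S] S))
    (hdual : ∀ x : E, ∑ i, α i x • e i = x)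
    (nabla : E →ₗ[R] KaehlerDifferential R S ⊗[S] E)
    (h : IsConnection R S nabla)
    (nstar : (E →ₗ[S] S) →ₗ[R] KaehlerDifferential R S ⊗[S] (E →ₗ[S] S))
    (hstar : ∀ (a : E →ₗ[S] S) (x : E),
      KaehlerDifferential.D R S (a x) = evDual R S x (nstar a) + evMod R S a (nabla x))
    (nT : E ⊗[S] (E →ₗ[S] S) →ₗ[R] KaehlerDifferential R S ⊗[S] (E ⊗[S] (E →ₗ[S] S)))
    (hT : ∀ (x : E) (a : E →ₗ[S] S),
      nT (x ⊗ₜ[S] a)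
        = LinearMap.lTensor (KaehlerDifferential R S)
            ((TensorProduct.mk S E (E →ₗ[S] S)).flip a) (nabla x)
          + LinearMap.lTensor (KaehlerDifferential R S)
              (TensorProduct.mk S E (E →ₗ[S] S) x) (nstar a)) :
    nT (∑ i, e i ⊗ₜ[S] α i) = 0 := by
  have hA (j : Fin n) : LinearMap.lTensor (KaehlerDifferential R S)
      ((TensorProduct.mk S E (E →ₗ[S] S)).flip (α j)) (nabla (e j))
      = ∑ i, evMod R S (α i) (nabla (e j)) ⊗ₜ[S] (e i ⊗ₜ[S] α j) := by
    conv_lhs => rw [← sum_evMod_tmul R hdual (nabla (e j))]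
    simp
  have hB (i : Fin n) : LinearMap.lTensor (KaehlerDifferential R S)
      (TensorProduct.mk S E (E →ₗ[S] S) (e i)) (nstar (α i))
      = ∑ j, evDual R S (e j) (nstar (α i)) ⊗ₜ[S] (e i ⊗ₜ[S] α j) := by
    conv_lhs => rw [← sum_evDual_tmul R hdual (nstar (α i))]
    simp
  rw [map_sum, ← sum_D_tmul_eq_zero hdual h]
  simp only [hT, hA, hB, hstar, TensorProduct.add_tmul, Finset.sum_add_distrib]
  rw [add_comm]
  congr 1
  exact Finset.sum_comm
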